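/- Fix p ∈ {1,…,k} such that f_p is not constant (i.e. β_{pr} ≠ 0 for some r), and let Υ be a real polynomial of degree at most d_p + 1 whose coefficient of x^(d_p+1) is γ. Then there exist real numbers c₀ and c_{ir} (i = 1,…,k; r = 1,…,d_i) such that, whenever x_{p1},…,x_{pd_p} are pairwise distinct, ∑_{q=1}^{d_p} [ P² Υ''(x_{pq}) − 2(m+1) P (∂P/∂x_{pq}) Υ'(x_{pq}) + (m+1)(m+2) (∂P/∂x_{pq})² Υ(x_{pq}) ] / Δ_{pq} = d_p(d_p+1) γ (∑_{j=1}^k f_j)² − 2(m+1)(d_p+1) γ (∑_{j=1}^k f_j) f_p + (m+1)(m+2) γ f_p² + c₀ + ∑_{i=1}^k ∑_{r=1}^{d_i} c_{ir} σ_r(x_{i·}). (That is, modulo terms affine-linear in the momentum coordinates, the sum equals the displayed quadratic expression in the f_j.) -/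

import Mathlib

noncomputable section

/-- The `r`-th elementary symmetric function of the values of `x` over the finite set `s`. -/
def esymmOn {n : ℕ} (s : Finset (Fin n)) (x : Fin n → ℝ) (r : ℕ) : ℝ :=
  ∑ t ∈ s.powersetCard r, ∏ i ∈ t, x i

/-- `σ_r(x₁,…,x_n)`, the `r`-th elementary symmetric polynomial of `x₁,…,x_n`. -/
def esymm {n : ℕ} (x : Fin n → ℝ) (r : ℕ) : ℝ :=
  esymmOn Finset.univ x r

/-- `σ_r(x̂_j)`, the `r`-th elementary symmetric polynomial of the `n - 1` numbers
`x_i`, `i ≠ j`. -/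
def esymmHat {n : ℕ} (x : Fin n → ℝ) (j : Fin n) (r : ℕ) : ℝ :=
  esymmOn (Finset.univ.erase j) x r

/-- `Δ_j(x) = ∏_{i ≠ j} (x_j - x_i)` (an empty product being `1`). -/
def Delta {n : ℕ} (x : Fin n → ℝ) (j : Fin n) : ℝ :=
  ∏ i ∈ Finset.univ.erase j, (x j - x i)

/-- `f_i(x) = ∑_{r=1}^{d_i} β_{ir} σ_r(x_{i·})`. -/
def fSV (k : ℕ) (d : Fin k → ℕ) (β : (i : Fin k) → Fin (d i) → ℝ)
    (x : (i : Fin k) → Fin (d i) → ℝ) (i : Fin k) : ℝ :=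
  ∑ r : Fin (d i), β i r * esymm (x i) ((r : ℕ) + 1)

/-- `P(x) = β₀ + ∑_i ∑_{r=1}^{d_i} β_{ir} σ_r(x_{i·})`. -/
def PSV (k : ℕ) (d : Fin k → ℕ) (β0 : ℝ) (β : (i : Fin k) → Fin (d i) → ℝ)
    (x : (i : Fin k) → Fin (d i) → ℝ) : ℝ :=
  β0 + ∑ i : Fin k, fSV k d β x i

/-- `∂P/∂x_{iq} = ∑_{r=1}^{d_i} β_{ir} σ_{r−1}(x̂_{iq})`. -/
def dPSV (k : ℕ) (d : Fin k → ℕ) (β : (i : Fin k) → Fin (d i) → ℝ)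
    (x : (i : Fin k) → Fin (d i) → ℝ) (i : Fin k) (q : Fin (d i)) : ℝ :=
  ∑ r : Fin (d i), β i r * esymmHat (x i) q (r : ℕ)

/-- The extremality equation of the separable Kähler geometry associated with the
product Segre–Veronese factorization structure: there are reals `α₀` and `α_{ir}` such
that for all `x ∈ Ω`,
`∑_i ∑_q [P² A_{iq}'' − 2(m+1) P (∂P/∂x_{iq}) A_{iq}' + (m+1)(m+2) (∂P/∂x_{iq})² A_{iq}] / Δ_{iq}
  = α₀ + ∑_i ∑_r α_{ir} σ_r(x_{i·})`. -/
def IsExtremalSV (k : ℕ) (d : Fin k → ℕ) (m : ℕ) (β0 : ℝ)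
    (β : (i : Fin k) → Fin (d i) → ℝ)
    (I : (i : Fin k) → Fin (d i) → Set ℝ)
    (A : (i : Fin k) → Fin (d i) → ℝ → ℝ) : Prop :=
  ∃ (α0 : ℝ) (α : (i : Fin k) → Fin (d i) → ℝ),
    ∀ x : (i : Fin k) → Fin (d i) → ℝ, (∀ i r, x i r ∈ I i r) →
      (∑ i : Fin k, ∑ q : Fin (d i),
        ((PSV k d β0 β x) ^ 2 * deriv (deriv (A i q)) (x i q)
          - 2 * ((m : ℝ) + 1) * PSV k d β0 β x * dPSV k d β x i q * deriv (A i q) (x i q)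
          + ((m : ℝ) + 1) * ((m : ℝ) + 2) * (dPSV k d β x i q) ^ 2 * A i q (x i q))
          / Delta (x i) q)
      = α0 + ∑ i : Fin k, ∑ r : Fin (d i), α i r * esymm (x i) ((r : ℕ) + 1)

section DividedDifferences

variable {n : ℕ} (x : Fin n → ℝ)

lemma esymmHat_zero (q : Fin n) : esymmHat x q 0 = 1 := by
  simp [esymmHat, esymmOn]

lemma esymm_zero : esymm x 0 = 1 := by
  simp [esymm, esymmOn]

lemma esymmHat_eq_zero (q : Fin n) {a : ℕ} (ha : n ≤ a) : esymmHat x q a = 0 := by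
  have hn : 0 < n := q.pos
  rw [esymmHat, esymmOn, Finset.powersetCard_eq_empty.2, Finset.sum_empty]
  rw [Finset.card_erase_of_mem (Finset.mem_univ q), Finset.card_univ, Fintype.card_fin]
  omega

lemma esymm_eq_zero {a : ℕ} (ha : n < a) : esymm x a = 0 := by
  rw [esymm, esymmOn, Finset.powersetCard_eq_empty.2, Finset.sum_empty]
  simpa using ha

lemma esymm_succ_eq_esymmHat (q : Fin n) (a : ℕ) :
    esymm x (a + 1) = esymmHat x q (a + 1) + x q * esymmHat x q a := by
  have hq : q ∉ (Finset.univ : Finset (Fin n)).erase q := Finset.notMem_erase q _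
  have hmem : ∀ {b : ℕ}, ∀ t ∈ ((Finset.univ : Finset (Fin n)).erase q).powersetCard b, q ∉ t :=
    fun t ht hqt => hq ((Finset.mem_powersetCard.1 ht).1 hqt)
  unfold esymm esymmHat esymmOn
  conv_lhs => rw [← Finset.insert_erase (Finset.mem_univ q)]
  rw [Finset.powersetCard_succ_insert hq, Finset.sum_union, Finset.sum_image, Finset.mul_sum]
  · congr 1
    exact Finset.sum_congr rfl fun t ht => Finset.prod_insert (hmem t ht)
  · intro s hs t ht hst
    rw [← Finset.erase_insert (hmem s hs), ← Finset.erase_insert (hmem t ht)]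
    exact congrArg (fun u => u.erase q) hst
  · rw [Finset.disjoint_left]
    intro t ht ht'
    obtain ⟨s, -, rfl⟩ := Finset.mem_image.1 ht'
    exact hmem _ ht (Finset.mem_insert_self q s)

/-- The sum `∑_q σ_a(x̂_q) x_q^j / Δ_q`. -/
def hatSum (a j : ℕ) : ℝ :=
  ∑ q, esymmHat x q a * x q ^ j / Delta x q

/-- The sum `∑_q σ_a(x̂_q) σ_b(x̂_q) x_q^j / Δ_q`. -/
def hatHatSum (a b j : ℕ) : ℝ :=
  ∑ q, esymmHat x q a * esymmHat x q b * x q ^ j / Delta x q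

lemma hatSum_succ_right (a j : ℕ) :
    hatSum x a (j + 1) = esymm x (a + 1) * hatSum x 0 j - hatSum x (a + 1) j := by
  simp only [hatSum, Finset.mul_sum, ← Finset.sum_sub_distrib]
  refine Finset.sum_congr rfl fun q _ => ?_
  rw [esymm_succ_eq_esymmHat x q a, esymmHat_zero]
  ring

lemma hatHatSum_succ_right (a b j : ℕ) :
    hatHatSum x a b (j + 1) = esymm x (a + 1) * hatSum x b j - hatHatSum x (a + 1) b j := by
  simp only [hatSum, hatHatSum, Finset.mul_sum, ← Finset.sum_sub_distrib]
  refine Finset.sum_congr rfl fun q _ => ?_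
  rw [esymm_succ_eq_esymmHat x q a]
  ring

lemma hatHatSum_comm (a b j : ℕ) : hatHatSum x a b j = hatHatSum x b a j := by
  simp only [hatHatSum, mul_comm (esymmHat x _ a)]

lemma hatHatSum_zero_left (b j : ℕ) : hatHatSum x 0 b j = hatSum x b j := by
  simp only [hatHatSum, hatSum, esymmHat_zero, one_mul]

variable {x}

lemma sum_eval_div_Delta (hx : Function.Injective x) {Q : Polynomial ℝ} (hQ : Q.degree < n) :
    ∑ q, Q.eval (x q) / Delta x q = Q.coeff (n - 1) := by
  have h := Lagrange.coeff_eq_sum (s := Finset.univ) (v := x) (P := Q) hx.injOn (by simpa using hQ)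
  simpa [Delta] using h.symm

lemma hatSum_zero_left (hx : Function.Injective x) {j : ℕ} (hj : j < n) :
    hatSum x 0 j = if j + 1 = n then 1 else 0 := by
  have h := sum_eval_div_Delta hx (Q := Polynomial.X ^ j)
    (by rw [Polynomial.degree_X_pow]; exact_mod_cast hj)
  simp only [Polynomial.eval_pow, Polynomial.eval_X, Polynomial.coeff_X_pow] at h
  simp only [hatSum, esymmHat_zero, one_mul, h]
  congr 1
  rw [eq_iff_iff]
  omega

lemma hatSum_of_add_lt (hx : Function.Injective x) (a : ℕ) :
    ∀ j, a + j < n → hatSum x a j = if a + j + 1 = n then (-1) ^ a else 0 := by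
  induction a with
  | zero => intro j hj; simpa using hatSum_zero_left hx (by omega : j < n)
  | succ a ih =>
    intro j hj
    have h := hatSum_succ_right x a j
    rw [hatSum_zero_left hx (by omega), if_neg (by omega), ih (j + 1) (by omega)] at h
    rw [show a + 1 + j + 1 = a + (j + 1) + 1 by omega, pow_succ]
    split_ifs at h ⊢ <;> linarith

lemma hatSum_of_le_add (hx : Function.Injective x) (j : ℕ) :
    ∀ a, j < n → n ≤ a + j → hatSum x a j = 0 := by
  induction j with
  | zero => intro a _ ha; simp [hatSum, esymmHat_eq_zero x _ (by omega : n ≤ a)]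
  | succ j ih =>
    intro a hj ha
    rw [hatSum_succ_right, hatSum_zero_left hx (by omega), if_neg (by omega),
      ih (a + 1) (by omega) (by omega)]
    ring

/-- For `j < n` the sum `∑_q σ_a(x̂_q) x_q^j / Δ_q` does not depend on `x`. -/
lemma hatSum_of_lt (hx : Function.Injective x) (a : ℕ) {j : ℕ} (hj : j < n) :
    hatSum x a j = if a + j + 1 = n then (-1) ^ a else 0 := by
  rcases lt_or_ge (a + j) n with h | h
  · exact hatSum_of_add_lt hx a j h
  · rw [hatSum_of_le_add hx j a hj h, if_neg (by omega)]

lemma hatSum_card (hx : Function.Injective x) (hn : 1 ≤ n) (a : ℕ) :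
    hatSum x a n = esymm x (a + 1) := by
  obtain ⟨j, rfl⟩ := Nat.exists_eq_add_of_le' hn
  rw [hatSum_succ_right, hatSum_zero_left hx (by omega), if_pos rfl,
    hatSum_of_lt hx (a + 1) (by omega), if_neg (by omega)]
  ring

/-- The sum `∑_q h_q Q(x_q) / Δ_q`, with `h_q = ∑_r b_r σ_{r-1}(x̂_q)` and `deg Q ≤ n`, equals
`Q.coeff n * ∑_r b_r σ_r(x)` up to a constant. -/
lemma exists_sum_hat_mul_eval (hn : 1 ≤ n) (b : Fin n → ℝ) {Q : Polynomial ℝ}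
    (hQ : Q.natDegree ≤ n) :
    ∃ C : ℝ, ∀ x : Fin n → ℝ, Function.Injective x →
      ∑ q, (∑ r : Fin n, b r * esymmHat x q r) * Q.eval (x q) / Delta x q
        = Q.coeff n * (∑ r : Fin n, b r * esymm x ((r : ℕ) + 1)) + C := by
  refine ⟨∑ r : Fin n, b r * ∑ j ∈ Finset.range n,
    Q.coeff j * if (r : ℕ) + j + 1 = n then (-1) ^ (r : ℕ) else 0, fun x hx => ?_⟩
  have h : ∑ q, (∑ r : Fin n, b r * esymmHat x q r) * Q.eval (x q) / Delta x q
      = ∑ r : Fin n, b r * ∑ j ∈ Finset.range (n + 1), Q.coeff j * hatSum x r j := by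
    simp only [Polynomial.eval_eq_sum_range' (Nat.lt_succ_of_le hQ), hatSum, Finset.sum_mul,
      Finset.mul_sum, Finset.sum_div]
    conv_rhs => rw [Finset.sum_comm_cycle]
    refine Finset.sum_congr rfl fun q _ => ?_
    rw [Finset.sum_comm]
    refine Finset.sum_congr rfl fun r _ => Finset.sum_congr rfl fun j _ => ?_
    ring
  rw [h, Finset.mul_sum, ← Finset.sum_add_distrib]
  refine Finset.sum_congr rfl fun r _ => ?_
  rw [Finset.sum_range_succ, hatSum_card hx hn,
    Finset.sum_congr rfl fun j hj => by rw [hatSum_of_lt hx r (Finset.mem_range.1 hj)]]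
  ring

end DividedDifferences

section AffineLinear

variable {X : Type*} {n : ℕ} {y : X → Fin n → ℝ} {V : Submodule ℝ (X → ℝ)}

lemma const_mem (h1 : (fun _ => 1) ∈ V) (c : ℝ) : (fun _ => c) ∈ V := by
  simpa [Pi.smul_def] using V.smul_mem c h1

lemma esymm_mem (h1 : (fun _ => 1) ∈ V)
    (hσ : ∀ r : Fin n, (fun t => esymm (y t) ((r : ℕ) + 1)) ∈ V) (a : ℕ) :
    (fun t => esymm (y t) a) ∈ V := by
  rcases a with _ | a
  · simpa only [esymm_zero] using h1
  · rcases lt_or_ge a n with h | h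
    · exact hσ ⟨a, h⟩
    · simp only [esymm_eq_zero _ (Nat.lt_succ_of_le h)]
      exact V.zero_mem

lemma esymm_mul_hatSum_mem (hy : ∀ t, Function.Injective (y t)) (h1 : (fun _ => 1) ∈ V)
    (hσ : ∀ r : Fin n, (fun t => esymm (y t) ((r : ℕ) + 1)) ∈ V) (a b : ℕ) {j : ℕ} (hj : j < n) :
    (fun t => esymm (y t) a * hatSum (y t) b j) ∈ V := by
  simp only [hatSum_of_lt (hy _) b hj, mul_comm (esymm _ a)]
  exact V.smul_mem _ (esymm_mem h1 hσ a)

lemma hatHatSum_zero_mem (hy : ∀ t, Function.Injective (y t)) (h1 : (fun _ => 1) ∈ V)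
    (hσ : ∀ r : Fin n, (fun t => esymm (y t) ((r : ℕ) + 1)) ∈ V) (hn : 1 ≤ n) (a : ℕ) :
    ∀ b, (fun t => hatHatSum (y t) a b 0) ∈ V := by
  induction a with
  | zero =>
    intro b
    simp only [hatHatSum_zero_left, hatSum_of_lt (hy _) b hn]
    exact const_mem h1 _
  | succ a ih =>
    intro b
    have h : ∀ t, hatHatSum (y t) (a + 1) b 0 = esymm (y t) (a + 1) * hatSum (y t) b 0
        - (esymm (y t) (b + 1) * hatSum (y t) a 0 - hatHatSum (y t) a (b + 1) 0) := fun t => by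
      have h₁ := hatHatSum_succ_right (y t) a b 0
      have h₂ := hatHatSum_succ_right (y t) b a 0
      rw [hatHatSum_comm _ b, hatHatSum_comm _ (b + 1)] at h₂
      linarith
    simp only [h]
    exact V.sub_mem (esymm_mul_hatSum_mem hy h1 hσ _ _ hn)
      (V.sub_mem (esymm_mul_hatSum_mem hy h1 hσ _ _ hn) (ih (b + 1)))

lemma hatHatSum_mem (hy : ∀ t, Function.Injective (y t)) (h1 : (fun _ => 1) ∈ V)
    (hσ : ∀ r : Fin n, (fun t => esymm (y t) ((r : ℕ) + 1)) ∈ V) (hn : 1 ≤ n) (b j : ℕ) :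
    ∀ a, j ≤ n → (fun t => hatHatSum (y t) a b j) ∈ V := by
  induction j with
  | zero => exact fun a _ => hatHatSum_zero_mem hy h1 hσ hn a b
  | succ j ih =>
    intro a hj
    simp only [hatHatSum_succ_right]
    exact V.sub_mem (esymm_mul_hatSum_mem hy h1 hσ _ _ hj) (ih (a + 1) (by omega))

/-- The sum `∑_q h_q² Q(x_q) / Δ_q`, with `h_q = ∑_r b_r σ_{r-1}(x̂_q)` and `deg Q ≤ n + 1`, equals
`Q.coeff (n + 1) * (∑_r b_r σ_r(x))²` modulo any space of functions that contains the constants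
and the elementary symmetric functions. -/
lemma sum_hat_sq_mul_eval_sub_mem (hy : ∀ t, Function.Injective (y t)) (h1 : (fun _ => 1) ∈ V)
    (hσ : ∀ r : Fin n, (fun t => esymm (y t) ((r : ℕ) + 1)) ∈ V) (hn : 1 ≤ n) (b : Fin n → ℝ)
    {Q : Polynomial ℝ} (hQ : Q.natDegree ≤ n + 1) :
    (fun t => ∑ q, (∑ r : Fin n, b r * esymmHat (y t) q r) ^ 2 * Q.eval (y t q) / Delta (y t) q
      - Q.coeff (n + 1) * (∑ r : Fin n, b r * esymm (y t) ((r : ℕ) + 1)) ^ 2) ∈ V := by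
  have h : ∀ t,
      ∑ q, (∑ r : Fin n, b r * esymmHat (y t) q r) ^ 2 * Q.eval (y t q) / Delta (y t) q
        - Q.coeff (n + 1) * (∑ r : Fin n, b r * esymm (y t) ((r : ℕ) + 1)) ^ 2
      = ∑ r : Fin n, ∑ s : Fin n, (b r * b s) *
          (∑ j ∈ Finset.range (n + 1), Q.coeff j * hatHatSum (y t) r s j
            - Q.coeff (n + 1) * hatHatSum (y t) (r + 1) s n) := fun t => by
    have h₁ : ∑ q, (∑ r : Fin n, b r * esymmHat (y t) q r) ^ 2 * Q.eval (y t q) / Delta (y t) q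
        = ∑ r : Fin n, ∑ s : Fin n, (b r * b s) *
            ∑ j ∈ Finset.range (n + 1 + 1), Q.coeff j * hatHatSum (y t) r s j := by
      simp only [Polynomial.eval_eq_sum_range' (Nat.lt_succ_of_le hQ), hatHatSum, sq,
        Finset.sum_mul, Finset.mul_sum, Finset.sum_div]
      conv_lhs => rw [Finset.sum_comm]
      conv_rhs => rw [Finset.sum_comm_cycle]
      refine Finset.sum_congr rfl fun j _ => ?_
      conv_rhs => rw [Finset.sum_comm_cycle]
      refine Finset.sum_congr rfl fun q _ => ?_
      rw [Finset.sum_comm]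
      refine Finset.sum_congr rfl fun r _ => Finset.sum_congr rfl fun s _ => ?_
      ring
    rw [h₁, sq, Finset.sum_mul_sum, Finset.mul_sum, ← Finset.sum_sub_distrib]
    refine Finset.sum_congr rfl fun r _ => ?_
    rw [Finset.mul_sum, ← Finset.sum_sub_distrib]
    refine Finset.sum_congr rfl fun s _ => ?_
    rw [Finset.sum_range_succ, hatHatSum_succ_right, hatSum_card (hy t) hn]
    ring
  simp only [h]
  have hsum : ∀ {ι : Type} (u : Finset ι) (g : ι → X → ℝ), (∀ i ∈ u, g i ∈ V) →
      (fun t => ∑ i ∈ u, g i t) ∈ V := fun u g hg => by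
    simpa [Finset.sum_fn] using V.sum_mem hg
  refine hsum _ _ fun r _ => hsum _ _ fun s _ => V.smul_mem (b r * b s) (V.sub_mem
    (hsum _ _ fun j hj => V.smul_mem _ (hatHatSum_mem hy h1 hσ hn _ _ _ ?_))
    (V.smul_mem _ (hatHatSum_mem hy h1 hσ hn _ _ _ le_rfl)))
  exact Nat.lt_succ_iff.1 (Finset.mem_range.1 hj)

end AffineLinear

/-- fix `p` with `f_p` non-constant (some `β_{pr} ≠ 0`) and a polynomial
`Υ` of degree at most `d_p + 1` with leading coefficient `γ = Υ.coeff (d_p+1)`. Then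
there are reals `c₀`, `c_{ir}` such that, whenever `x_{p1},…,x_{pd_p}` are pairwise
distinct, `∑_q [P² Υ'' − 2(m+1) P (∂P/∂x_{pq}) Υ' + (m+1)(m+2) (∂P/∂x_{pq})² Υ]/Δ_{pq}`
equals `d_p(d_p+1) γ (∑_j f_j)² − 2(m+1)(d_p+1) γ (∑_j f_j) f_p + (m+1)(m+2) γ f_p²`
up to the affine-linear term `c₀ + ∑_i ∑_r c_{ir} σ_r(x_{i·})`. -/
theorem statement18 (k : ℕ) (hk : 1 ≤ k) (d : Fin k → ℕ) (hd : ∀ i, 1 ≤ d i)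
    (m : ℕ) (hm : m = ∑ i, d i)
    (β0 : ℝ) (β : (i : Fin k) → Fin (d i) → ℝ)
    (p : Fin k) (hp : ∃ r : Fin (d p), β p r ≠ 0)
    (Υ : Polynomial ℝ) (hΥ : Υ.natDegree ≤ d p + 1) :
    ∃ (c0 : ℝ) (c : (i : Fin k) → Fin (d i) → ℝ),
      ∀ x : (i : Fin k) → Fin (d i) → ℝ, Function.Injective (x p) →
        (∑ q : Fin (d p),
          ((PSV k d β0 β x) ^ 2 * Υ.derivative.derivative.eval (x p q)
            - 2 * ((m : ℝ) + 1) * PSV k d β0 β x * dPSV k d β x p q *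
                Υ.derivative.eval (x p q)
            + ((m : ℝ) + 1) * ((m : ℝ) + 2) * (dPSV k d β x p q) ^ 2 * Υ.eval (x p q))
            / Delta (x p) q)
        = (d p : ℝ) * ((d p : ℝ) + 1) * Υ.coeff (d p + 1) *
              (∑ j : Fin k, fSV k d β x j) ^ 2
          - 2 * ((m : ℝ) + 1) * ((d p : ℝ) + 1) * Υ.coeff (d p + 1) *
              (∑ j : Fin k, fSV k d β x j) * fSV k d β x p
          + ((m : ℝ) + 1) * ((m : ℝ) + 2) * Υ.coeff (d p + 1) * (fSV k d β x p) ^ 2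
          + c0 + ∑ i : Fin k, ∑ r : Fin (d i), c i r * esymm (x i) ((r : ℕ) + 1) := by
  have hn : 1 ≤ d p := hd p
  let X := {x : (i : Fin k) → Fin (d i) → ℝ // Function.Injective (x p)}
  let u : (Σ i, Fin (d i)) → X → ℝ := fun ir t => esymm (t.1 ir.1) ((ir.2 : ℕ) + 1)
  let V : Submodule ℝ (X → ℝ) := Submodule.span ℝ (insert (fun _ => 1) (Set.range u))
  have h1 : (fun _ => 1) ∈ V := Submodule.subset_span (Set.mem_insert _ _)
  have hu : ∀ ir, u ir ∈ V := fun ir =>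
    Submodule.subset_span (Set.mem_insert_of_mem _ (Set.mem_range_self ir))
  have hf : ∀ i, (fun t : X => fSV k d β t.1 i) ∈ V := fun i => by
    have h := V.sum_mem (t := Finset.univ) fun r _ => V.smul_mem (β i r) (hu ⟨i, r⟩)
    convert h using 1
    ext t
    simp [fSV, u]
  have hF : (fun t : X => ∑ j, fSV k d β t.1 j) ∈ V := by
    have h := V.sum_mem (t := Finset.univ) fun i _ => hf i
    convert h using 1
    ext t
    simp
  set γ := Υ.coeff (d p + 1)
  have hΥ₁ : Υ.derivative.natDegree ≤ d p := (Polynomial.natDegree_derivative_le _).trans (by omega)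
  have hΥ₂ : Υ.derivative.derivative.degree < d p := by
    refine Polynomial.degree_lt_iff_coeff_zero _ _ |>.2 fun j hj => ?_
    rw [Polynomial.coeff_derivative, Polynomial.coeff_derivative,
      Polynomial.coeff_eq_zero_of_natDegree_lt (by omega)]
    ring
  have hc₁ : Υ.derivative.coeff (d p) = ((d p : ℝ) + 1) * γ := by
    rw [Polynomial.coeff_derivative, mul_comm]
  have hc₂ : Υ.derivative.derivative.coeff (d p - 1) = (d p : ℝ) * ((d p : ℝ) + 1) * γ := by
    rw [Polynomial.coeff_derivative, Nat.sub_add_cancel hn, hc₁, Nat.cast_sub hn]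
    push_cast
    ring
  obtain ⟨C, hC⟩ := exists_sum_hat_mul_eval hn (β p) hΥ₁
  have hA := sum_hat_sq_mul_eval_sub_mem (y := fun t : X => t.1 p) (V := V) (fun t => t.2) h1
    (fun r => hu ⟨p, r⟩) hn (β p) hΥ
  have hg := V.add_mem (V.add_mem (V.add_mem
    (const_mem h1 (β0 ^ 2 * (d p * (d p + 1) * γ) - 2 * (m + 1) * C * β0))
    (V.smul_mem (2 * β0 * (d p * (d p + 1) * γ) - 2 * (m + 1) * C) hF))
    (V.smul_mem (-(2 * (m + 1) * β0 * ((d p + 1) * γ))) (hf p)))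
    (V.smul_mem (((m : ℝ) + 1) * (m + 2)) hA)
  obtain ⟨c0, z, hz, hgz⟩ := Submodule.mem_span_insert.1 hg
  obtain ⟨c, rfl⟩ := (Submodule.mem_span_range_iff_exists_fun ℝ).1 hz
  refine ⟨c0, fun i r => c ⟨i, r⟩, fun x hx => ?_⟩
  have key := congrFun hgz ⟨x, hx⟩
  simp only [Pi.add_apply, Pi.smul_apply, smul_eq_mul, Finset.sum_apply, u, mul_one] at key
  rw [Fintype.sum_sigma] at key
  have hsplit : ∑ q : Fin (d p),
      ((PSV k d β0 β x) ^ 2 * Υ.derivative.derivative.eval (x p q)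
        - 2 * ((m : ℝ) + 1) * PSV k d β0 β x * dPSV k d β x p q * Υ.derivative.eval (x p q)
        + ((m : ℝ) + 1) * ((m : ℝ) + 2) * (dPSV k d β x p q) ^ 2 * Υ.eval (x p q))
        / Delta (x p) q
      = (PSV k d β0 β x) ^ 2 * ∑ q, Υ.derivative.derivative.eval (x p q) / Delta (x p) q
        - 2 * ((m : ℝ) + 1) * PSV k d β0 β x *
            ∑ q, dPSV k d β x p q * Υ.derivative.eval (x p q) / Delta (x p) q
        + ((m : ℝ) + 1) * ((m : ℝ) + 2) *
            ∑ q, (dPSV k d β x p q) ^ 2 * Υ.eval (x p q) / Delta (x p) q := by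
    simp only [Finset.mul_sum, ← Finset.sum_sub_distrib, ← Finset.sum_add_distrib]
    exact Finset.sum_congr rfl fun q _ => by ring
  have hC' : ∑ q, dPSV k d β x p q * Υ.derivative.eval (x p q) / Delta (x p) q
      = ((d p : ℝ) + 1) * γ * fSV k d β x p + C := hc₁ ▸ hC (x p) hx
  rw [hsplit, sum_eval_div_Delta hx hΥ₂, hc₂, hC', PSV]
  simp only [dPSV]
  rw [show (∑ r : Fin (d p), β p r * esymm (x p) ((r : ℕ) + 1)) = fSV k d β x p from rfl] at key
  linear_combination key

end
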